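/- Let η ≠ 0 and ℓ > −1. If x ∈ ℝ satisfies φ_{ℓ,η}(x) = 0 and φ_{ℓ+2,η}(x) = 0, then x = −(ℓ+1)(ℓ+2)/η; in particular, φ_{ℓ,η} and φ_{ℓ+2,η} have at most one common real zero. -/

import Mathlib

noncomputable def coulombCoeff (l η : ℝ) : ℕ → ℝ
  | 0 => 1
  | 1 => η / (l + 1)
  | (k + 2) =>
      (2 * η * coulombCoeff l η (k + 1) - coulombCoeff l η k) /
        (((k : ℝ) + 2) * (((k : ℝ) + 2) + 2 * l + 1))

/-- The function φ_{ℓ,η}, real-valued on ℝ. -/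
noncomputable def coulombPhi (l η x : ℝ) : ℝ := ∑' k : ℕ, coulombCoeff l η k * x ^ k

open Filter Topology

theorem coulombCoeff_zero (l η : ℝ) : coulombCoeff l η 0 = 1 := by
  simp [coulombCoeff]

theorem coulombCoeff_one (l η : ℝ) : coulombCoeff l η 1 = η / (l + 1) := by
  simp [coulombCoeff]

theorem coulombCoeff_rec {l : ℝ} (hl : -1 < l) (η : ℝ) (k : ℕ) :
    ((k : ℝ) + 2) * (k + 2 * l + 3) * coulombCoeff l η (k + 2) =
      2 * η * coulombCoeff l η (k + 1) - coulombCoeff l η k := by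
  have hk : (0 : ℝ) ≤ k := k.cast_nonneg
  have h1 : ((k : ℝ) + 2) ≠ 0 := by positivity
  have h2 : ((k : ℝ) + 2) + 2 * l + 1 ≠ 0 := by linarith
  rw [coulombCoeff]
  field_simp
  ring

/-- Lowering relation `(2ℓ+3) φ_ℓ = (2ℓ+3) φ_{ℓ+1} + x φ_{ℓ+1}' + η x φ_{ℓ+1} / (ℓ+1)`
at the level of coefficients. -/
theorem coulombCoeff_lowering {l : ℝ} (hl : -1 < l) (η : ℝ) (k : ℕ) :
    (2 * l + 3) * coulombCoeff l η (k + 1) =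
      (2 * l + 4 + k) * coulombCoeff (l + 1) η (k + 1)
        + η / (l + 1) * coulombCoeff (l + 1) η k := by
  have h1 : l + 1 ≠ 0 := by linarith
  have h2 : l + 2 ≠ 0 := by linarith
  have h3 : l + 1 + 1 ≠ 0 := by linarith
  have hl' : -1 < l + 1 := by linarith
  induction k using Nat.strong_induction_on with
  | _ k ih =>
    match k with
    | 0 =>
      simp only [zero_add, coulombCoeff_one, coulombCoeff_zero]
      field_simp
      push_cast
      ring
    | 1 =>
      have i0 := ih 0 (by norm_num)
      have ra := coulombCoeff_rec hl η 0
      have rb := coulombCoeff_rec hl' η 0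
      simp only [zero_add, coulombCoeff_zero, coulombCoeff_one, Nat.cast_zero, Nat.cast_one,
        Nat.reduceAdd] at *
      have h5 : 2 * l + 3 ≠ 0 := by linarith
      have h6 : 2 * (l + 1) + 3 ≠ 0 := by linarith
      have ea : coulombCoeff l η 2 = (2 * η * (η / (l + 1)) - 1) / (2 * (2 * l + 3)) := by
        rw [eq_div_iff (by simpa using h5)]; linarith
      have eb : coulombCoeff (l + 1) η 2 =
          (2 * η * (η / (l + 1 + 1)) - 1) / (2 * (2 * (l + 1) + 3)) := by
        rw [eq_div_iff (by simpa using h6)]; linarith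
      rw [ea, eb]
      field_simp
      ring
    | k + 2 =>
      have hk : (0 : ℝ) ≤ k := k.cast_nonneg
      have i0 := ih k (by omega)
      have i1 := ih (k + 1) (by omega)
      have ra := coulombCoeff_rec hl η (k + 1)
      have rb := coulombCoeff_rec hl' η (k + 1)
      have rb' := coulombCoeff_rec hl' η k
      have hη : η = η / (l + 1) * (l + 1) := by field_simp
      generalize η / (l + 1) = h at *
      simp only [add_assoc, Nat.reduceAdd] at *
      push_cast at *
      have hne : ((k : ℝ) + 3) * (k + 2 * l + 4) ≠ 0 := by
        have : (0 : ℝ) < k + 2 * l + 4 := by linarith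
        positivity
      apply mul_left_cancel₀ hne
      generalize coulombCoeff l η (k + 3) = a3 at *
      generalize coulombCoeff l η (k + 2) = a2 at *
      generalize coulombCoeff l η (k + 1) = a1 at *
      generalize coulombCoeff (l + 1) η (k + 3) = b3 at *
      generalize coulombCoeff (l + 1) η (k + 2) = b2 at *
      generalize coulombCoeff (l + 1) η (k + 1) = b1 at *
      generalize coulombCoeff (l + 1) η k = b0 at *
      linear_combination (2 * l + 3) * ra + 2 * η * i1 - i0 - (k + 2 * l + 4) * rb - h * rb'
        + 2 * b2 * hη

/-- Raising relation between `φ_ℓ` and `φ_{ℓ+1}` at the level of coefficients. -/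
theorem coulombCoeff_raising {l : ℝ} (hl : -1 < l) (η : ℝ) (k : ℕ) :
    (1 + (η / (l + 1)) ^ 2) * coulombCoeff (l + 1) η k =
      (2 * l + 3) * (η / (l + 1) * coulombCoeff l η (k + 1)
        - (k + 2) * coulombCoeff l η (k + 2)) := by
  have i0 := coulombCoeff_lowering hl η k
  have i1 := coulombCoeff_lowering hl η (k + 1)
  have rb := coulombCoeff_rec (show -1 < l + 1 by linarith) η k
  have hη : η = η / (l + 1) * (l + 1) := by
    have : l + 1 ≠ 0 := by linarith
    field_simp
  generalize η / (l + 1) = h at *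
  push_cast at i1
  linear_combination (-h) * i0 + (k + 2) * i1 + rb + 2 * coulombCoeff (l + 1) η (k + 1) * hη

theorem coulombCoeff_three_term {l : ℝ} (hl : -1 < l) (η : ℝ) (k : ℕ) :
    coulombCoeff l η (k + 2) = coulombCoeff (l + 1) η (k + 2)
      + η / ((l + 1) * (l + 2)) * coulombCoeff (l + 1) η (k + 1)
      - (1 + (η / (l + 2)) ^ 2) / ((2 * l + 3) * (2 * l + 5)) * coulombCoeff (l + 2) η k := by
  have d := coulombCoeff_lowering hl η (k + 1)
  have u := coulombCoeff_raising (show -1 < l + 1 by linarith) η k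
  rw [show l + 1 + 1 = l + 2 by ring] at u
  have h1 : l + 1 ≠ 0 := by linarith
  have h2 : l + 2 ≠ 0 := by linarith
  have h3 : 2 * l + 3 ≠ 0 := by linarith
  have h5 : 2 * l + 5 ≠ 0 := by linarith
  have he : η / ((l + 1) * (l + 2)) = (η / (l + 1) + η / (l + 2)) / (2 * l + 3) := by
    rw [eq_div_iff h3]
    field_simp
    ring
  rw [he, div_mul_eq_mul_div, div_mul_eq_mul_div, u, show 2 * (l + 1) + 3 = 2 * l + 5 by ring,
    mul_comm (2 * l + 5), mul_div_mul_right _ _ h5]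
  push_cast at d
  simp only [add_assoc, Nat.reduceAdd] at d ⊢
  generalize η / (l + 1) = h at *
  generalize η / (l + 2) = h' at *
  generalize hs : 2 * l + 3 = s at *
  field_simp
  linear_combination d + coulombCoeff (l + 1) η (k + 2) * hs

theorem abs_coulombCoeff_le {l : ℝ} (hl : -1 < l) (η : ℝ) {C : ℝ} (hC : 1 ≤ C)
    (hC' : |η| / (l + 1) ≤ C) (k : ℕ) :
    |coulombCoeff l η k| ≤ C * ((2 * |η| + 1) ^ k / k.factorial) := by
  have hη := abs_nonneg η
  induction k using Nat.twoStepInduction with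
  | zero => simpa [coulombCoeff_zero] using hC
  | one =>
    rw [coulombCoeff_one, abs_div, abs_of_pos (show 0 < l + 1 by linarith)]
    refine hC'.trans ?_
    simp only [pow_one, Nat.factorial_one, Nat.cast_one, div_one]
    nlinarith
  | more k i0 i1 =>
    have hk : (0 : ℝ) ≤ k := k.cast_nonneg
    have r := congrArg abs (coulombCoeff_rec hl η k)
    have hp : 0 < ((k : ℝ) + 2) * (k + 2 * l + 3) := mul_pos (by linarith) (by linarith)
    rw [abs_mul, abs_of_pos hp] at r
    have t : |2 * η * coulombCoeff l η (k + 1) - coulombCoeff l η k| ≤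
        2 * |η| * |coulombCoeff l η (k + 1)| + |coulombCoeff l η k| := by
      refine (abs_sub _ _).trans ?_
      simp [abs_mul]
    set B := 2 * |η| + 1 with hB
    have hB1 : 1 ≤ B := by linarith
    have hf : (0 : ℝ) < k.factorial := by positivity
    have q : ((k : ℝ) + 2) * (k + 1) * |coulombCoeff l η (k + 2)| ≤
        C * (B ^ (k + 2) / k.factorial) := by
      calc ((k : ℝ) + 2) * (k + 1) * |coulombCoeff l η (k + 2)|
          ≤ ((k : ℝ) + 2) * (k + 2 * l + 3) * |coulombCoeff l η (k + 2)| := by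
            gcongr ?_ * ?_ * _
            linarith
        _ ≤ 2 * |η| * (C * (B ^ (k + 1) / (k + 1).factorial)) + C * (B ^ k / k.factorial) := by
            rw [r]
            refine t.trans ?_
            gcongr
        _ ≤ 2 * |η| * (C * (B ^ (k + 1) / k.factorial)) + C * (B ^ (k + 1) / k.factorial) := by
            gcongr <;> first | exact hB1 | omega
        _ = C * (B ^ (k + 2) / k.factorial) := by
            rw [hB]; ring
    have e : C * (B ^ (k + 2) / (k + 2).factorial) =
        C * (B ^ (k + 2) / k.factorial) / (((k : ℝ) + 2) * (k + 1)) := by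
      rw [Nat.factorial_succ, Nat.factorial_succ]
      push_cast
      field_simp
      ring
    rw [e, le_div_iff₀ (by positivity)]
    linarith

theorem norm_coulombCoeff_mul_pow_le {l : ℝ} (hl : -1 < l) (η x : ℝ) {C : ℝ} (hC : 1 ≤ C)
    (hC' : |η| / (l + 1) ≤ C) (k : ℕ) :
    ‖coulombCoeff l η k * x ^ k‖ ≤ C * (((2 * |η| + 1) * |x|) ^ k / k.factorial) := by
  rw [norm_mul, norm_pow, Real.norm_eq_abs, Real.norm_eq_abs]
  calc |coulombCoeff l η k| * |x| ^ k
      ≤ C * ((2 * |η| + 1) ^ k / k.factorial) * |x| ^ k := by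
        gcongr
        exact abs_coulombCoeff_le hl η hC hC' k
    _ = C * (((2 * |η| + 1) * |x|) ^ k / k.factorial) := by
        rw [mul_pow]; ring

theorem summable_coulombCoeff_mul_pow {l : ℝ} (hl : -1 < l) (η x : ℝ) :
    Summable fun k : ℕ => coulombCoeff l η k * x ^ k :=
  .of_norm_bounded ((Real.summable_pow_div_factorial _).mul_left _)
    (norm_coulombCoeff_mul_pow_le hl η x (le_max_left 1 (|η| / (l + 1))) (le_max_right _ _))

/-- The three-term recurrence in `ℓ`. -/
theorem coulombPhi_three_term {l : ℝ} (hl : -1 < l) (η x : ℝ) :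
    coulombPhi l η x = (1 + η / ((l + 1) * (l + 2)) * x) * coulombPhi (l + 1) η x
      - (1 + (η / (l + 2)) ^ 2) / ((2 * l + 3) * (2 * l + 5)) * x ^ 2
        * coulombPhi (l + 2) η x := by
  have sa := summable_coulombCoeff_mul_pow hl η x
  have sb := summable_coulombCoeff_mul_pow (show -1 < l + 1 by linarith) η x
  have sd := summable_coulombCoeff_mul_pow (show -1 < l + 2 by linarith) η x
  have ha := sa.sum_add_tsum_nat_add 2
  have hb1 := sb.sum_add_tsum_nat_add 1
  have hb2 := sb.sum_add_tsum_nat_add 2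
  have key : ∑' k : ℕ, coulombCoeff l η (k + 2) * x ^ (k + 2) =
      ∑' k : ℕ, coulombCoeff (l + 1) η (k + 2) * x ^ (k + 2)
      + η / ((l + 1) * (l + 2)) * x * ∑' k : ℕ, coulombCoeff (l + 1) η (k + 1) * x ^ (k + 1)
      - (1 + (η / (l + 2)) ^ 2) / ((2 * l + 3) * (2 * l + 5)) * x ^ 2
        * ∑' k : ℕ, coulombCoeff (l + 2) η k * x ^ k := by
    have s2 := (summable_nat_add_iff 2).mpr sb
    have s1 := ((summable_nat_add_iff 1).mpr sb).mul_left (η / ((l + 1) * (l + 2)) * x)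
    have s0 := sd.mul_left ((1 + (η / (l + 2)) ^ 2) / ((2 * l + 3) * (2 * l + 5)) * x ^ 2)
    rw [← tsum_mul_left, ← tsum_mul_left, ← s2.tsum_add s1, ← (s2.add s1).tsum_sub s0]
    refine tsum_congr fun k => ?_
    rw [coulombCoeff_three_term hl]
    ring
  have h1 : l + 1 ≠ 0 := by linarith
  have h2 : l + 2 ≠ 0 := by linarith
  have h2' : l + 1 + 1 = l + 2 := by ring
  have hh : η / (l + 1) = η / (l + 2) + η / ((l + 1) * (l + 2)) := by
    field_simp
    ring
  simp only [Finset.sum_range_succ, Finset.sum_range_zero, coulombCoeff_zero, coulombCoeff_one,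
    h2'] at ha hb1 hb2
  simp only [coulombPhi]
  linear_combination -ha + key + hb2 + η / ((l + 1) * (l + 2)) * x * hb1 + x * hh

theorem tendsto_coulombPhi_add_nat {l : ℝ} (hl : -1 < l) (η x : ℝ) :
    Tendsto (fun n : ℕ => coulombPhi (l + n) η x) atTop (𝓝 1) := by
  have hln (n : ℕ) : -1 < l + n := by
    have : (0 : ℝ) ≤ n := n.cast_nonneg
    linarith
  set C := max 1 (|η| / (l + 1))
  have hC1 : 1 ≤ C := le_max_left _ _
  have hCn (n : ℕ) : |η| / (l + n + 1) ≤ C := by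
    refine le_trans ?_ (le_max_right _ _)
    have : 0 < l + 1 := by linarith
    gcongr
    simp
  have hlim : Tendsto (fun n : ℕ => l + (n : ℝ)) atTop atTop :=
    tendsto_atTop_add_const_left _ _ tendsto_natCast_atTop_atTop
  have hcoeff (k : ℕ) : Tendsto (fun n : ℕ => coulombCoeff (l + n) η k) atTop
      (𝓝 (if k = 0 then 1 else 0)) := by
    induction k using Nat.twoStepInduction with
    | zero => simp [coulombCoeff_zero]
    | one =>
      simp only [coulombCoeff_one]
      exact (tendsto_atTop_add_const_right _ 1 hlim).const_div_atTop η
    | more k i0 i1 =>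
      simp only [coulombCoeff]
      refine ((i1.const_mul (2 * η)).sub i0).div_atTop ?_
      refine Tendsto.const_mul_atTop (by positivity) (tendsto_atTop_add_const_right _ 1 ?_)
      exact tendsto_atTop_add_const_left _ _ (hlim.const_mul_atTop two_pos)
  have h := tendsto_tsum_of_dominated_convergence
    (f := fun (n : ℕ) (k : ℕ) => coulombCoeff (l + n) η k * x ^ k)
    ((Real.summable_pow_div_factorial ((2 * |η| + 1) * |x|)).mul_left C)
    (fun k => (hcoeff k).mul_const (x ^ k))
    (.of_forall fun n k => norm_coulombCoeff_mul_pow_le (hln n) η x hC1 (hCn n) k)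
  simpa [coulombPhi] using h

theorem coulombPhi_zero_right {l : ℝ} (η : ℝ) : coulombPhi l η 0 = 1 := by
  rw [coulombPhi, tsum_eq_single 0 fun k hk => by simp [hk]]
  simp [coulombCoeff_zero]

/-- `φ_ℓ` and `φ_{ℓ+1}` have no common real zero. -/
theorem coulombPhi_succ_ne_zero {l : ℝ} (hl : -1 < l) {η x : ℝ} (h0 : coulombPhi l η x = 0) :
    coulombPhi (l + 1) η x ≠ 0 := by
  intro h1
  have hx : x ≠ 0 := by
    rintro rfl
    simp [coulombPhi_zero_right] at h0
  have hall (n : ℕ) : coulombPhi (l + n) η x = 0 ∧ coulombPhi (l + n + 1) η x = 0 := by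
    induction n with
    | zero => simpa using ⟨h0, h1⟩
    | succ n ih =>
      have hn : -1 < l + n := by
        have : (0 : ℝ) ≤ n := n.cast_nonneg
        linarith
      have t := coulombPhi_three_term hn η x
      have h3 : 0 < 2 * (l + n) + 3 := by linarith
      have h5 : 0 < 2 * (l + n) + 5 := by linarith
      rw [ih.1, ih.2, mul_zero, zero_sub, eq_comm, neg_eq_zero] at t
      have ht := (mul_eq_zero.mp t).resolve_left (by positivity)
      push_cast
      rw [← add_assoc, add_assoc _ 1 1, one_add_one_eq_two]
      exact ⟨ih.2, ht⟩
  have h := tendsto_coulombPhi_add_nat hl η x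
  simp only [(hall _).1] at h
  exact zero_ne_one (tendsto_nhds_unique tendsto_const_nhds h)

/-- Proposition 6.1: for η ≠ 0 and ℓ > −1, any common real zero of φ_{ℓ,η} and φ_{ℓ+2,η}
equals −(ℓ+1)(ℓ+2)/η; in particular the two functions have at most one common real zero. -/
theorem stmt_19 (l η : ℝ) (hl : -1 < l) (hη : η ≠ 0) :
    ∀ x : ℝ, coulombPhi l η x = 0 → coulombPhi (l + 2) η x = 0 →
      x = -((l + 1) * (l + 2)) / η := by
  intro x h0 h2
  have t := coulombPhi_three_term hl η x
  rw [h0, h2, mul_zero, sub_zero, eq_comm] at t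
  have ht := (mul_eq_zero.mp t).resolve_right (coulombPhi_succ_ne_zero hl h0)
  have h1 : l + 1 ≠ 0 := by linarith
  have h2 : l + 2 ≠ 0 := by linarith
  field_simp at ht ⊢
  linarith
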